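/- arXiv:2007.01733 — 2 statements merged into one kernel-verified Lean document; each statement's English description precedes it below -/
import Mathlib

section
/- Let M be a term of Λ!⊕, let M ⇛ D with D = p₁·N₁ + … + p_n·N_n (finite support), and let Nᵢ ⇛ Eᵢ for each i ≤ n. Then (1) M ⇛ Σ_{i=1}^n pᵢ·Eᵢ, and (2) the derivation can be chosen so that |M ⇛ Σᵢ pᵢ·Eᵢ| ≤ |M ⇛ D| + max_{i=1}^n |Nᵢ ⇛ Eᵢ|. -/
namespace PSTA

/-- Raw terms of the calculus Λ!⊕. -/
inductive Tm : Type
  | var   : ℕ → Tm                               -- x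
  | lam   : ℕ → Tm → Tm                          -- λx.M
  | blam  : ℕ → Tm → Tm                          -- λ!x.M
  | app   : Tm → Tm → Tm                         -- M N
  | bang  : Tm → Tm                              -- !M
  | der   : Tm → Tm                              -- d(M)
  | pair  : Tm → Tm → Tm                         -- ⟨M,N⟩
  | proj  : Tm → Tm                              -- proj(M)
  | copy  : Tm → Tm → ℕ → ℕ → Tm → Tm → Tm       -- copy^V N as x,y in ⟨P,Q⟩
  deriving DecidableEq

namespace Tm

/-- Free variables. -/
def fv : Tm → Finset ℕ
  | var x => {x}
  | lam x M => fv M \ {x}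
  | blam x M => fv M \ {x}
  | app M N => fv M ∪ fv N
  | bang M => fv M
  | der M => fv M
  | pair M N => fv M ∪ fv N
  | proj M => fv M
  | copy V N x y P Q => fv V ∪ fv N ∪ (fv P \ {x}) ∪ (fv Q \ {y})

/-- Number of free occurrences of a variable in a term. -/
def count : Tm → ℕ → ℕ
  | var y, x => if y = x then 1 else 0
  | lam y M, x => if y = x then 0 else count M x
  | blam y M, x => if y = x then 0 else count M x
  | app M N, x => count M x + count N x
  | bang M, x => count M x
  | der M, x => count M x
  | pair M N, x => count M x + count N x
  | proj M, x => count M x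
  | copy V N y z P Q, x =>
      count V x + count N x + (if y = x then 0 else count P x) +
        (if z = x then 0 else count Q x)

/-- Number of free occurrences of a variable that are at the surface,
i.e. not inside any subterm `!N` or `d(N)`. -/
def scount : Tm → ℕ → ℕ
  | var y, x => if y = x then 1 else 0
  | lam y M, x => if y = x then 0 else scount M x
  | blam y M, x => if y = x then 0 else scount M x
  | app M N, x => scount M x + scount N x
  | bang _, _ => 0
  | der _, _ => 0
  | pair M N, x => scount M x + scount N x
  | proj M, x => scount M x
  | copy V N y z P Q, x =>
      scount V x + scount N x + (if y = x then 0 else scount P x) +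
        (if z = x then 0 else scount Q x)

/-- Size (number of symbols) of a term. -/
def size : Tm → ℕ
  | var _ => 1
  | lam _ M => size M + 1
  | blam _ M => size M + 1
  | app M N => size M + size N + 1
  | bang M => size M + 1
  | der M => size M + 1
  | pair M N => size M + size N + 1
  | proj M => size M + 1
  | copy V N _ _ P Q => size V + size N + size P + size Q + 2

/-- Substitution M[N/x] (binder-respecting). -/
def subst : Tm → ℕ → Tm → Tm
  | var y, x, N => if y = x then N else var y
  | lam y M, x, N => if y = x then lam y M else lam y (subst M x N)
  | blam y M, x, N => if y = x then blam y M else blam y (subst M x N)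
  | app M P, x, N => app (subst M x N) (subst P x N)
  | bang M, x, N => bang (subst M x N)
  | der M, x, N => der (subst M x N)
  | pair M P, x, N => pair (subst M x N) (subst P x N)
  | proj M, x, N => proj (subst M x N)
  | copy V P y z Q R, x, N =>
      copy (subst V x N) (subst P x N) y z
        (if y = x then Q else subst Q x N) (if z = x then R else subst R x N)

end Tm

open Tm

/-- x is s-linear in M: x occurs free exactly once in M and this occurrence
is at the surface (not inside a `!` or a `d`). -/
def SLinearIn (x : ℕ) (M : Tm) : Prop := M.count x = 1 ∧ M.scount x = 1

/-- M is s-linear, i.e. M is a term of Λ!⊕. -/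
def SLin : Tm → Prop
  | .var _ => True
  | .lam x M => SLinearIn x M ∧ SLin M
  | .blam _ M => SLin M
  | .app M N => SLin M ∧ SLin N
  | .bang M => SLin M
  | .der M => SLin M
  | .pair M N => SLin M ∧ SLin N
  | .proj M => SLin M
  | .copy V N x y P Q =>
      SLin V ∧ SLin N ∧ SLin P ∧ SLin Q ∧ SLinearIn x P ∧ SLinearIn y Q

/-- The value grammar V ::= x | λx.V | V V | ⟨V,V⟩. -/
def VGram : Tm → Prop
  | .var _ => True
  | .lam _ M => VGram M
  | .app M N => VGram M ∧ VGram N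
  | .pair M N => VGram M ∧ VGram N
  | _ => False

/-- β-reduction (λx.U)V → U[V/x], closed under arbitrary contexts. -/
inductive VBeta : Tm → Tm → Prop
  | beta (x : ℕ) (U V : Tm) : VBeta (.app (.lam x U) V) (subst U x V)
  | lamC (x : ℕ) {M M' : Tm} : VBeta M M' → VBeta (.lam x M) (.lam x M')
  | blamC (x : ℕ) {M M' : Tm} : VBeta M M' → VBeta (.blam x M) (.blam x M')
  | appL {M M' : Tm} (N : Tm) : VBeta M M' → VBeta (.app M N) (.app M' N)
  | appR (M : Tm) {N N' : Tm} : VBeta N N' → VBeta (.app M N) (.app M N')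
  | bangC {M M' : Tm} : VBeta M M' → VBeta (.bang M) (.bang M')
  | derC {M M' : Tm} : VBeta M M' → VBeta (.der M) (.der M')
  | pairL {M M' : Tm} (N : Tm) : VBeta M M' → VBeta (.pair M N) (.pair M' N)
  | pairR (M : Tm) {N N' : Tm} : VBeta N N' → VBeta (.pair M N) (.pair M N')
  | projC {M M' : Tm} : VBeta M M' → VBeta (.proj M) (.proj M')
  | copyV {V V' : Tm} (N : Tm) (x y : ℕ) (P Q : Tm) :
      VBeta V V' → VBeta (.copy V N x y P Q) (.copy V' N x y P Q)
  | copyN (V : Tm) {N N' : Tm} (x y : ℕ) (P Q : Tm) :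
      VBeta N N' → VBeta (.copy V N x y P Q) (.copy V N' x y P Q)
  | copyP (V N : Tm) (x y : ℕ) {P P' : Tm} (Q : Tm) :
      VBeta P P' → VBeta (.copy V N x y P Q) (.copy V N x y P' Q)
  | copyQ (V N : Tm) (x y : ℕ) (P : Tm) {Q Q' : Tm} :
      VBeta Q Q' → VBeta (.copy V N x y P Q) (.copy V N x y P Q')

def Closed (M : Tm) : Prop := M.fv = ∅

/-- Values: closed (s-linear) terms of the V-grammar that are β-normal. -/
def IsValue (V : Tm) : Prop :=
  VGram V ∧ SLin V ∧ Closed V ∧ ∀ W, ¬ VBeta V W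

open scoped Classical in
/-- Surface-preserving substitution M{N/x}. -/
noncomputable def ssubst : Tm → ℕ → Tm → Tm
  | M, x, .bang Q =>
      if h : ∃ p : Tm × ℕ, x ∉ (p.1).fv ∧ M = subst p.1 p.2 (.der (.var x)) then
        ssubst h.choose.1 h.choose.2 Q
      else subst M x (.bang Q)
  | M, x, N => subst M x N
  termination_by M x N => sizeOf N

/-- One-step surface reduction M → M₁, M₂. -/
inductive Step : Tm → Tm → Tm → Prop
  | beta (x : ℕ) (M N : Tm) :
      Step (.app (.lam x M) N) (subst M x N) (subst M x N)
  | bbeta (x : ℕ) (M N : Tm) :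
      Step (.app (.blam x M) (.bang N)) (ssubst M x (.bang N)) (ssubst M x (.bang N))
  | projPair (M N : Tm) : Step (.proj (.pair M N)) M N
  | copyV (U V : Tm) (x y : ℕ) (M N : Tm) : IsValue U → IsValue V →
      Step (.copy U V x y M N) (.pair (subst M x V) (subst N y V))
        (.pair (subst M x V) (subst N y V))
  | lamC (x : ℕ) {M M₁ M₂ : Tm} :
      Step M M₁ M₂ → Step (.lam x M) (.lam x M₁) (.lam x M₂)
  | blamC (x : ℕ) {M M₁ M₂ : Tm} :
      Step M M₁ M₂ → Step (.blam x M) (.blam x M₁) (.blam x M₂)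
  | appL {M M₁ M₂ : Tm} (N : Tm) :
      Step M M₁ M₂ → Step (.app M N) (.app M₁ N) (.app M₂ N)
  | appR (M : Tm) {N N₁ N₂ : Tm} :
      Step N N₁ N₂ → Step (.app M N) (.app M N₁) (.app M N₂)
  | derC {M M₁ M₂ : Tm} : Step M M₁ M₂ → Step (.der M) (.der M₁) (.der M₂)
  | pairL {M M₁ M₂ : Tm} (N : Tm) :
      Step M M₁ M₂ → Step (.pair M N) (.pair M₁ N) (.pair M₂ N)
  | pairR (M : Tm) {N N₁ N₂ : Tm} :
      Step N N₁ N₂ → Step (.pair M N) (.pair M N₁) (.pair M N₂)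
  | projC {M M₁ M₂ : Tm} : Step M M₁ M₂ → Step (.proj M) (.proj M₁) (.proj M₂)
  | copyN (V : Tm) {N N₁ N₂ : Tm} (x y : ℕ) (P Q : Tm) :
      Step N N₁ N₂ → Step (.copy V N x y P Q) (.copy V N₁ x y P Q) (.copy V N₂ x y P Q)
  | copyP (V N : Tm) (x y : ℕ) {P P₁ P₂ : Tm} (Q : Tm) :
      Step P P₁ P₂ → Step (.copy V N x y P Q) (.copy V N x y P₁ Q) (.copy V N x y P₂ Q)
  | copyQ (V N : Tm) (x y : ℕ) (P : Tm) {Q Q₁ Q₂ : Tm} :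
      Step Q Q₁ Q₂ → Step (.copy V N x y P Q) (.copy V N x y P Q₁) (.copy V N x y P Q₂)

/-- Surface normal forms. -/
def SNF (M : Tm) : Prop := ∀ N₁ N₂, ¬ Step M N₁ N₂

/-- The distribution ½·D₁ + ½·D₂. -/
noncomputable def mix (D₁ D₂ : PMF Tm) : PMF Tm :=
  (PMF.bernoulli 2⁻¹ (by norm_num)).bind fun b => if b then D₁ else D₂

/-- Derivations of the multi-step surface reduction M ⇒ D. -/
inductive MDeriv : Tm → PMF Tm → Type
  | s1 (S : Tm) : SNF S → MDeriv S (PMF.pure S)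
  | s2 {M M₁ M₂ : Tm} {D₁ D₂ : PMF Tm} :
      Step M M₁ M₂ → MDeriv M₁ D₁ → MDeriv M₂ D₂ → MDeriv M (mix D₁ D₂)

/-- Size of a derivation of M ⇒ D. -/
def MDeriv.size : ∀ {M : Tm} {D : PMF Tm}, MDeriv M D → ℕ
  | _, _, .s1 _ _ => 0
  | _, _, .s2 _ π₁ π₂ => max π₁.size π₂.size + 1

/-- The set of subjects N of premises N → N', N'' of s2 rules occurring in a
derivation of M ⇒ D. -/
def MDeriv.redexes : ∀ {M : Tm} {D : PMF Tm}, MDeriv M D → Set Tm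
  | _, _, .s1 _ _ => ∅
  | M, _, .s2 _ π₁ π₂ => insert M (π₁.redexes ∪ π₂.redexes)

/-- Derivations of the multi-step reduction M ⇛ D (t1 applies to any term). -/
inductive TDeriv : Tm → PMF Tm → Type
  | t1 (M : Tm) : TDeriv M (PMF.pure M)
  | t2 {M M₁ M₂ : Tm} {D₁ D₂ : PMF Tm} :
      Step M M₁ M₂ → TDeriv M₁ D₁ → TDeriv M₂ D₂ → TDeriv M (mix D₁ D₂)

/-- Size of a derivation of M ⇛ D. -/
def TDeriv.size : ∀ {M : Tm} {D : PMF Tm}, TDeriv M D → ℕ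
  | _, _, .t1 _ => 0
  | _, _, .t2 _ π₁ π₂ => max π₁.size π₂.size + 1

/-- Types of PSTA. -/
inductive Ty : Type
  | tvar : ℕ → Ty            -- α
  | arr  : Ty → Ty → Ty      -- σ ⊸ A
  | wth  : Ty → Ty → Ty      -- A & B
  | all  : ℕ → Ty → Ty       -- ∀α.A
  | bang : Ty → Ty           -- !σ
  deriving DecidableEq

namespace Ty

/-- Size (number of symbols) of a type. -/
def size : Ty → ℕ
  | tvar _ => 1
  | arr σ A => size σ + size A + 1
  | wth A B => size A + size B + 1
  | all _ A => size A + 1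
  | bang σ => size σ + 1

/-- Free type variables. -/
def fv : Ty → Finset ℕ
  | tvar α => {α}
  | arr σ A => fv σ ∪ fv A
  | wth A B => fv A ∪ fv B
  | all α A => fv A \ {α}
  | bang σ => fv σ

/-- Type substitution A⟨B/α⟩. -/
def subst : Ty → ℕ → Ty → Ty
  | tvar β, α, B => if β = α then B else tvar β
  | arr σ A, α, B => arr (subst σ α B) (subst A α B)
  | wth A C, α, B => wth (subst A α B) (subst C α B)
  | all β A, α, B => if β = α then all β A else all β (subst A α B)
  | bang σ, α, B => bang (subst σ α B)

end Ty

/-- Grammar check: `okTy true σ` means σ is a (possibly exponential) type,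
`okTy false A` means A is a linear type. -/
def okTy : Bool → Ty → Prop
  | _, .tvar _ => True
  | _, .arr σ A => okTy true σ ∧ okTy false A
  | _, .wth A B => okTy false A ∧ okTy false B
  | _, .all _ A => okTy false A
  | b, .bang σ => b = true ∧ okTy true σ

/-- Linear types A. -/
def IsLinear (A : Ty) : Prop := okTy false A

/-- Exponential types σ. -/
def IsTy (σ : Ty) : Prop := okTy true σ

/-- ∀!-lazy check with polarity (`true` = positive position): no occurrence of
`!` anywhere, no occurrence of `∀` in negative position. -/
def lazyAux : Bool → Ty → Prop
  | _, .tvar _ => True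
  | b, .arr σ A => lazyAux (!b) σ ∧ lazyAux b A
  | b, .wth A B => lazyAux b A ∧ lazyAux b B
  | true, .all _ A => lazyAux true A
  | false, .all _ _ => False
  | _, .bang _ => False

/-- ∀!-lazy types. -/
def LazyTy (A : Ty) : Prop := lazyAux true A

/-- Typing contexts: multisets of assumptions x : σ. -/
abbrev Ctx := Multiset (ℕ × Ty)

/-- ∀!-lazy contexts. -/
def LazyCtx (Γ : Ctx) : Prop := ∀ p ∈ Γ, LazyTy p.2

/-- Simultaneous substitution M[d(y₁)/x₁, …, d(yₙ)/xₙ]. -/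
def substDers (M : Tm) (prs : List (ℕ × ℕ)) : Tm :=
  prs.foldl (fun N q => Tm.subst N q.1 (.der (.var q.2))) M

/-- Simultaneous substitution M[d(x)/x₁, …, d(x)/xₙ]. -/
def substDersOne (M : Tm) (xs : List ℕ) (x : ℕ) : Tm :=
  xs.foldl (fun N xi => Tm.subst N xi (.der (.var x))) M

/-- PSTA typing derivations of Γ ⊢ M : σ. -/
inductive Deriv : Ctx → Tm → Ty → Type
  | ax (x : ℕ) (A : Ty) : IsLinear A → Deriv {(x, A)} (.var x) A
  | larr {Γ : Ctx} {x : ℕ} {A B : Ty} {M : Tm} :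
      IsLinear A → IsLinear B →
      Deriv ((x, A) ::ₘ Γ) M B → Deriv Γ (.lam x M) (.arr A B)
  | earr {Γ : Ctx} {x : ℕ} {σ B : Ty} {M : Tm} :
      IsTy σ → IsLinear B →
      Deriv ((x, .bang σ) ::ₘ Γ) M B → Deriv Γ (.blam x M) (.arr (.bang σ) B)
  | app {Γ Γ' : Ctx} {M N : Tm} {σ A : Ty} :
      IsLinear A →
      Deriv Γ M (.arr σ A) → Deriv Γ' N σ → Deriv (Γ + Γ') (.app M N) A
  | withI {Δ : Ctx} {N M₁ M₂ V : Tm} {x₁ x₂ : ℕ} {C C₁ C₂ : Ty} :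
      LazyCtx Δ → LazyTy C → LazyTy C₁ → LazyTy C₂ → IsValue V →
      Deriv Δ N C → Deriv {(x₁, C)} M₁ C₁ → Deriv {(x₂, C)} M₂ C₂ →
      Deriv 0 V C →
      Deriv Δ (.copy V N x₁ x₂ M₁ M₂) (.wth C₁ C₂)
  | pairI {M₁ M₂ : Tm} {C₁ C₂ : Ty} :
      LazyTy C₁ → LazyTy C₂ →
      Deriv 0 M₁ C₁ → Deriv 0 M₂ C₂ → Deriv 0 (.pair M₁ M₂) (.wth C₁ C₂)
  | withE {Δ : Ctx} {M : Tm} {C : Ty} :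
      LazyCtx Δ → LazyTy C →
      Deriv Δ M (.wth C C) → Deriv Δ (.proj M) C
  | sp (L : List (ℕ × Ty)) (ys : List ℕ) {M : Tm} {τ : Ty} :
      ys.length = L.length →
      Deriv (↑L) M τ →
      Deriv (↑(List.zipWith (fun y p => (y, Ty.bang p.2)) ys L))
        (.bang (substDers M ((L.map Prod.fst).zip ys))) (.bang τ)
  | m {Γ : Ctx} (xs : List ℕ) (x : ℕ) {σ τ : Ty} {M : Tm} :
      Deriv (Γ + ↑(xs.map fun xi => (xi, σ))) M τ →
      Deriv ((x, .bang σ) ::ₘ Γ) (substDersOne M xs x) τ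
  | allI {Γ : Ctx} {M : Tm} (α γ : ℕ) {A : Ty} :
      (∀ p ∈ Γ, γ ∉ Ty.fv p.2) →
      Deriv Γ M (Ty.subst A α (.tvar γ)) → Deriv Γ M (.all α A)
  | allE {Γ : Ctx} {M : Tm} (α : ℕ) {A : Ty} (B : Ty) :
      IsLinear B →
      Deriv Γ M (.all α A) → Deriv Γ M (Ty.subst A α B)

/-- Weight w(D, r) of a derivation. -/
def weight (r : ℕ) : ∀ {Γ : Ctx} {M : Tm} {σ : Ty}, Deriv Γ M σ → ℕ
  | _, _, _, .ax _ _ _ => 1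
  | _, _, _, .larr _ _ D => weight r D + 1
  | _, _, _, .earr _ _ D => weight r D + 1
  | _, _, _, .app _ D D' => weight r D + weight r D' + 1
  | _, _, _, .withI _ _ _ _ _ D₁ D₂ D₃ D₄ =>
      weight r D₁ + weight r D₂ + weight r D₃ + weight r D₄ + 2
  | _, _, _, .pairI _ _ D₁ D₂ => weight r D₁ + weight r D₂ + 1
  | _, _, _, .withE _ _ D => weight r D + 1
  | _, _, _, .sp (M := M) L _ _ D =>
      r * (weight r D + ((L.map Prod.fst).filter (fun z => decide (z ∈ M.fv))).length) + 1
  | _, _, _, .m (M := M) xs _ D =>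
      weight r D + (xs.filter (fun z => decide (z ∈ M.fv))).length
  | _, _, _, .allI _ _ _ D => weight r D
  | _, _, _, .allE _ _ _ D => weight r D

/-- Maximum m-rank of m instances in a derivation (0 if none). -/
def rkAux : ∀ {Γ : Ctx} {M : Tm} {σ : Ty}, Deriv Γ M σ → ℕ
  | _, _, _, .ax _ _ _ => 0
  | _, _, _, .larr _ _ D => rkAux D
  | _, _, _, .earr _ _ D => rkAux D
  | _, _, _, .app _ D D' => max (rkAux D) (rkAux D')
  | _, _, _, .withI _ _ _ _ _ D₁ D₂ D₃ D₄ =>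
      max (max (rkAux D₁) (rkAux D₂)) (max (rkAux D₃) (rkAux D₄))
  | _, _, _, .pairI _ _ D₁ D₂ => max (rkAux D₁) (rkAux D₂)
  | _, _, _, .withE _ _ D => rkAux D
  | _, _, _, .sp _ _ _ D => rkAux D
  | _, _, _, .m (M := M) xs _ D =>
      max (rkAux D) (xs.filter (fun z => decide (z ∈ M.fv))).length
  | _, _, _, .allI _ _ _ D => rkAux D
  | _, _, _, .allE _ _ _ D => rkAux D

/-- The m-rank rk(D) of a derivation. -/
def rk {Γ : Ctx} {M : Tm} {σ : Ty} (D : Deriv Γ M σ) : ℕ := max 1 (rkAux D)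

/-- The depth d(D): maximal number of sp instances on a path from the
conclusion to an axiom. -/
def depth : ∀ {Γ : Ctx} {M : Tm} {σ : Ty}, Deriv Γ M σ → ℕ
  | _, _, _, .ax _ _ _ => 0
  | _, _, _, .larr _ _ D => depth D
  | _, _, _, .earr _ _ D => depth D
  | _, _, _, .app _ D D' => max (depth D) (depth D')
  | _, _, _, .withI _ _ _ _ _ D₁ D₂ D₃ D₄ =>
      max (max (depth D₁) (depth D₂)) (max (depth D₃) (depth D₄))
  | _, _, _, .pairI _ _ D₁ D₂ => max (depth D₁) (depth D₂)
  | _, _, _, .withE _ _ D => depth D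
  | _, _, _, .sp _ _ _ D => depth D + 1
  | _, _, _, .m _ _ D => depth D
  | _, _, _, .allI _ _ _ D => depth D
  | _, _, _, .allE _ _ _ D => depth D

/-- A derivation contains no instance of sp and m. -/
def spmFree : ∀ {Γ : Ctx} {M : Tm} {σ : Ty}, Deriv Γ M σ → Prop
  | _, _, _, .ax _ _ _ => True
  | _, _, _, .larr _ _ D => spmFree D
  | _, _, _, .earr _ _ D => spmFree D
  | _, _, _, .app _ D D' => spmFree D ∧ spmFree D'
  | _, _, _, .withI _ _ _ _ _ D₁ D₂ D₃ D₄ =>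
      spmFree D₁ ∧ spmFree D₂ ∧ spmFree D₃ ∧ spmFree D₄
  | _, _, _, .pairI _ _ D₁ D₂ => spmFree D₁ ∧ spmFree D₂
  | _, _, _, .withE _ _ D => spmFree D
  | _, _, _, .sp _ _ _ _ => False
  | _, _, _, .m _ _ _ => False
  | _, _, _, .allI _ _ _ D => spmFree D
  | _, _, _, .allE _ _ _ D => spmFree D


/-- i-fold application of `!` to a type. -/
def bangsTy : ℕ → Ty → Ty
  | 0, t => t
  | i+1, t => .bang (bangsTy i t)

/-- The indexed type N_i = ∀α. !^i(α⊸α) ⊸ α ⊸ α of natural numbers. -/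
def NTy (i : ℕ) : Ty :=
  .all 0 (.arr (bangsTy i (.arr (.tvar 0) (.tvar 0))) (.arr (.tvar 0) (.tvar 0)))

/-- i-fold application of `!` to a term. -/
def bangsTm : ℕ → Tm → Tm
  | 0, M => M
  | i+1, M => .bang (bangsTm i M)

/-- i-fold application of `d` to a term. -/
def dersTm : ℕ → Tm → Tm
  | 0, M => M
  | i+1, M => .der (dersTm i M)

/-- Body d^i(f)(… (d^i(f) x)…) of an indexed numeral, with f = var 0, x = var 1. -/
def numBody (i : ℕ) : ℕ → Tm
  | 0 => .var 1
  | n+1 => .app (dersTm i (.var 0)) (numBody i n)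

/-- The indexed numeral n̲_i = λ!f.λx. d^i(f)(… (d^i(f) x)…). -/
def num (i n : ℕ) : Tm := .blam 0 (.lam 1 (numBody i n))

/-- M reduces in one surface step to N, i.e. N is one of the two reducts of a
surface reduction step from M. -/
def Reduces (M N : Tm) : Prop := ∃ N₁ N₂, Step M N₁ N₂ ∧ (N = N₁ ∨ N = N₂)


/-- Sequencing a mixture with a kernel is the mixture of the sequenced distributions. -/
theorem mix_bind (D₁ D₂ : PMF Tm) (E : Tm → PMF Tm) :
    (mix D₁ D₂).bind E = mix (D₁.bind E) (D₂.bind E) := by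
  unfold mix
  rw [PMF.bind_bind]
  congr 1
  funext b
  cases b <;> rfl

/-- The support of a mixture contains the supports of both components. -/
theorem support_union_subset_support_mix (D₁ D₂ : PMF Tm) :
    D₁.support ∪ D₂.support ⊆ (mix D₁ D₂).support := by
  rintro N (hN | hN)
  · exact (PMF.mem_support_bind_iff _ _ _).2 ⟨true, by
      rw [PMF.mem_support_iff, PMF.bernoulli_apply]; simp, hN⟩
  · exact (PMF.mem_support_bind_iff _ _ _).2 ⟨false, by
      rw [PMF.mem_support_iff, PMF.bernoulli_apply]; simp, hN⟩

/-- if M ⇛ D with D = p₁·N₁ + … + pₙ·Nₙ (support contained in the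
finite set s) and Nᵢ ⇛ Eᵢ for each i, then M ⇛ Σᵢ pᵢ·Eᵢ (i.e. D.bind E) with a
derivation of size ≤ |M ⇛ D| + maxᵢ |Nᵢ ⇛ Eᵢ|. -/
theorem tstep_bind (M : Tm) (hM : SLin M) (D : PMF Tm) (π : TDeriv M D)
    (s : Finset Tm) (hs : D.support ⊆ ↑s) (E : Tm → PMF Tm)
    (ρ : (N : Tm) → N ∈ s → TDeriv N (E N)) :
    ∃ τ : TDeriv M (D.bind E),
      τ.size ≤ π.size + s.attach.sup (fun N => (ρ N.1 N.2).size) := by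
  clear hM
  induction π with
  | t1 M =>
    have hMs : M ∈ s := by simpa using hs
    rw [PMF.pure_bind]
    exact ⟨ρ M hMs, le_add_left
      (Finset.le_sup (f := fun N : s => (ρ N.1 N.2).size) (Finset.mem_attach s ⟨M, hMs⟩))⟩
  | @t2 M M₁ M₂ D₁ D₂ h π₁ π₂ ih₁ ih₂ =>
    have hD := (support_union_subset_support_mix D₁ D₂).trans hs
    obtain ⟨τ₁, h₁⟩ := ih₁ (Set.subset_union_left.trans hD)
    obtain ⟨τ₂, h₂⟩ := ih₂ (Set.subset_union_right.trans hD)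
    rw [mix_bind]
    refine ⟨.t2 h τ₁ τ₂, ?_⟩
    simp only [TDeriv.size]
    omega

end PSTA
end

section
/- Representing polynomial functions: let p : ℕ → ℕ be a polynomial with natural-number coefficients and degree d = deg(p). Then there exists a term p̲ of Λ!⊕ such that x : !^d N ⊢ p̲ : N_{2d+1} is derivable in PSTA, and p̲ represents p: for every n ∈ ℕ, the term p̲{!^d n̲ / x} (the surface-preserving substitution of !^d n̲ for x in p̲) multi-step surface reduces (⇒) to the Dirac distribution on the indexed numeral p(n)̲_{2d+1}. -/
namespace PSTA

open Tm

/-! ### Iterated application and the representing terms -/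

/-- The `n`-fold application `G (⋯ (G t)⋯)`. -/
def iter (G : Tm) : ℕ → Tm → Tm
  | 0, t => t
  | n+1, t => .app G (iter G n t)

/-- Horner scheme: with `F` iterating the function to be applied and `u` a numeral, the body
`F^{c k} (u !(λz. F^{c (k-1)} (u !(⋯) z)) z)`, where `z = var 1`. -/
def horner (F u : Tm) (c : ℕ → ℕ) : ℕ → Tm
  | 0 => iter F (c 0) (.var 1)
  | k+1 => iter F (c (k+1)) (.app (.app u (.bang (.lam 1 (horner F u c k)))) (.var 1))

/-- The number of occurrences of `F` in `horner F u c k`. -/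
def headCount (c : ℕ → ℕ) : ℕ → ℕ
  | 0 => c 0
  | k+1 => c (k+1) + headCount c k

/-- The value computed by the Horner scheme at `n`. -/
def hornerVal (c : ℕ → ℕ) (n : ℕ) : ℕ → ℕ
  | 0 => c 0
  | k+1 => c (k+1) + n * hornerVal c n k

theorem numBody_eq_iter (i n : ℕ) : numBody i n = iter (dersTm i (.var 0)) n (.var 1) := by
  induction n with
  | zero => rfl
  | succ n ih => simp [numBody, iter, ih]

theorem iter_add (G t : Tm) (a b : ℕ) : iter G (a + b) t = iter G a (iter G b t) := by
  induction a with
  | zero => simp [iter]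
  | succ a ih => rw [Nat.succ_add]; simp [iter, ih]

theorem subst_iter (G t : Tm) (n x : ℕ) (N : Tm) :
    Tm.subst (iter G n t) x N = iter (Tm.subst G x N) n (Tm.subst t x N) := by
  induction n with
  | zero => rfl
  | succ n ih => simp [iter, Tm.subst, ih]

theorem subst_dersTm (j : ℕ) (M : Tm) (x : ℕ) (N : Tm) :
    Tm.subst (dersTm j M) x N = dersTm j (Tm.subst M x N) := by
  induction j with
  | zero => rfl
  | succ j ih => simp [dersTm, Tm.subst, ih]

theorem subst_dersTm_var_of_ne (j : ℕ) {z x : ℕ} (h : z ≠ x) (N : Tm) :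
    Tm.subst (dersTm j (.var z)) x N = dersTm j (.var z) := by
  simp [subst_dersTm, Tm.subst, h]

theorem dersTm_der (j : ℕ) (M : Tm) : dersTm j (.der M) = dersTm (j + 1) M := by
  induction j with
  | zero => rfl
  | succ j ih => simp only [dersTm] at ih ⊢; rw [ih]

theorem subst_num (i n : ℕ) {x : ℕ} (h0 : x ≠ 0) (h1 : x ≠ 1) (N : Tm) :
    Tm.subst (num i n) x N = num i n := by
  simp [num, Tm.subst, numBody_eq_iter, subst_iter, subst_dersTm, h0.symm, h1.symm]

theorem subst_horner (F u : Tm) (c : ℕ → ℕ) (k : ℕ) {x : ℕ} (hx : x ≠ 1) (N : Tm) :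
    Tm.subst (horner F u c k) x N = horner (Tm.subst F x N) (Tm.subst u x N) c k := by
  induction k with
  | zero => simp [horner, subst_iter, Tm.subst, hx.symm]
  | succ k ih => simp [horner, subst_iter, Tm.subst, hx.symm, ih]

theorem iter_congr_head {G G' : Tm} {n : ℕ} (h : n = 0 ∨ G = G') (t : Tm) :
    iter G n t = iter G' n t := by
  rcases h with rfl | rfl <;> rfl

theorem horner_congr_head {F F' : Tm} (u : Tm) (c : ℕ → ℕ) {k : ℕ}
    (h : headCount c k = 0) : horner F u c k = horner F' u c k := by
  induction k with
  | zero => exact iter_congr_head (.inl h) _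
  | succ k ih =>
    simp only [headCount, Nat.add_eq_zero_iff] at h
    simp only [horner, ih h.2]
    exact iter_congr_head (.inl h.1) _

/-! ### Deterministic surface reduction -/

/-- Reflexive-transitive closure of the non-branching steps `M → N`. -/
abbrev Red : Tm → Tm → Prop := Relation.ReflTransGen fun M N => Step M N N

theorem Red.map {f : Tm → Tm} (hf : ∀ {M N}, Step M N N → Step (f M) (f N) (f N)) {M N : Tm}
    (h : Red M N) : Red (f M) (f N) := by
  induction h with
  | refl => exact .refl
  | tail _ h ih => exact ih.tail (hf h)

theorem Red.lam (x : ℕ) {M N : Tm} (h : Red M N) : Red (.lam x M) (.lam x N) :=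
  h.map (.lamC x)

theorem Red.blam (x : ℕ) {M N : Tm} (h : Red M N) : Red (.blam x M) (.blam x N) :=
  h.map (.blamC x)

theorem Red.appL (P : Tm) {M N : Tm} (h : Red M N) : Red (.app M P) (.app N P) :=
  h.map (f := (Tm.app · P)) (.appL P)

theorem Red.appR (P : Tm) {M N : Tm} (h : Red M N) : Red (.app P M) (.app P N) :=
  h.map (.appR P)

theorem Red.iter (G : Tm) (n : ℕ) {M N : Tm} (h : Red M N) :
    Red (iter G n M) (iter G n N) := by
  induction n with
  | zero => exact h
  | succ n ih => exact ih.appR G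

theorem mix_self (D : PMF Tm) : mix D D = D := by
  simp [mix]

theorem Red.mderiv {M S : Tm} (h : Red M S) (hS : SNF S) : Nonempty (MDeriv M (PMF.pure S)) := by
  induction h using Relation.ReflTransGen.head_induction_on with
  | refl => exact ⟨.s1 S hS⟩
  | head hstep _ ih =>
    obtain ⟨π⟩ := ih
    rw [← mix_self (PMF.pure S)]
    exact ⟨.s2 hstep π π⟩

theorem not_step_dersTm_var (j z : ℕ) (N₁ N₂ : Tm) : ¬ Step (dersTm j (.var z)) N₁ N₂ := by
  induction j generalizing N₁ N₂ with
  | zero => rintro ⟨⟩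
  | succ j ih =>
    intro h
    cases h with
    | derC h => exact ih _ _ h

theorem not_step_app_dersTm {j z : ℕ} {M : Tm} (hM : SNF M) (N₁ N₂ : Tm) :
    ¬ Step (.app (dersTm j (.var z)) M) N₁ N₂ := by
  generalize hF : dersTm j (.var z) = F
  intro h
  cases h with
  | beta => cases j <;> simp [dersTm] at hF
  | bbeta => cases j <;> simp [dersTm] at hF
  | appL _ h => exact not_step_dersTm_var j z _ _ (hF ▸ h)
  | appR _ h => exact hM _ _ h

theorem snf_numBody (i n : ℕ) : SNF (numBody i n) := by
  induction n with
  | zero => rintro _ _ ⟨⟩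
  | succ n ih => exact not_step_app_dersTm ih

theorem snf_num (i n : ℕ) : SNF (num i n) := by
  intro _ _ h
  cases h with
  | blamC _ h =>
    cases h with
    | lamC _ h => exact snf_numBody i n _ _ h

/-! ### Surface-preserving substitution -/

theorem ssubst_of_ne_bang (M : Tm) (x : ℕ) {N : Tm} (h : ∀ Q, N ≠ .bang Q) :
    ssubst M x N = Tm.subst M x N := by
  rw [ssubst]
  exact h

/-- To compute `ssubst M x (!Q)` it suffices to exhibit one decomposition of `M` and to check
that all of them lead to the same result. -/
theorem ssubst_bang_eq {M Q R : Tm} {x : ℕ}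
    (hex : ∃ P y, x ∉ Tm.fv P ∧ M = Tm.subst P y (.der (.var x)))
    (h : ∀ P y, x ∉ Tm.fv P → M = Tm.subst P y (.der (.var x)) → ssubst P y Q = R) :
    ssubst M x (.bang Q) = R := by
  have hex' : ∃ p : Tm × ℕ, x ∉ (p.1).fv ∧ M = Tm.subst p.1 p.2 (.der (.var x)) :=
    let ⟨P, y, hP⟩ := hex
    ⟨(P, y), hP⟩
  rw [ssubst, dif_pos hex']
  exact h _ _ hex'.choose_spec.1 hex'.choose_spec.2

theorem app_eq_subst_der {A B P : Tm} {x y : ℕ} (hx : x ∉ Tm.fv P)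
    (h : .app A B = Tm.subst P y (.der (.var x))) :
    ∃ A' B', P = .app A' B' ∧ x ∉ Tm.fv A' ∧ x ∉ Tm.fv B' ∧
      A = Tm.subst A' y (.der (.var x)) ∧ B = Tm.subst B' y (.der (.var x)) := by
  cases P <;> simp only [Tm.subst] at h
  case app A' B' =>
    simp only [Tm.fv, Finset.mem_union, not_or] at hx
    injection h with h1 h2
    exact ⟨A', B', rfl, hx.1, hx.2, h1, h2⟩
  all_goals (try split at h) <;> simp at h

theorem bang_eq_subst_der {A P : Tm} {x y : ℕ} (hx : x ∉ Tm.fv P)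
    (h : .bang A = Tm.subst P y (.der (.var x))) :
    ∃ A', P = .bang A' ∧ x ∉ Tm.fv A' ∧ A = Tm.subst A' y (.der (.var x)) := by
  cases P <;> simp only [Tm.subst] at h
  case bang A' =>
    injection h with h1
    exact ⟨A', rfl, hx, h1⟩
  all_goals (try split at h) <;> simp at h

theorem lam_eq_subst_der {A P : Tm} {x y z : ℕ} (hzx : x ≠ z) (hx : x ∉ Tm.fv P)
    (h : .lam z A = Tm.subst P y (.der (.var x))) :
    ∃ A', P = .lam z A' ∧ x ∉ Tm.fv A' ∧
      A = if z = y then A' else Tm.subst A' y (.der (.var x)) := by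
  cases P <;> simp only [Tm.subst] at h
  case lam w A' =>
    simp only [Tm.fv, Finset.mem_sdiff, Finset.mem_singleton] at hx
    split at h <;> injection h with h1 h2 <;> subst h1 <;>
      exact ⟨A', rfl, by tauto, by simp_all⟩
  all_goals (try split at h) <;> simp at h

theorem blam_eq_subst_der {A P : Tm} {x y z : ℕ} (hzx : x ≠ z) (hx : x ∉ Tm.fv P)
    (h : .blam z A = Tm.subst P y (.der (.var x))) :
    ∃ A', P = .blam z A' ∧ x ∉ Tm.fv A' ∧
      A = if z = y then A' else Tm.subst A' y (.der (.var x)) := by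
  cases P <;> simp only [Tm.subst] at h
  case blam w A' =>
    simp only [Tm.fv, Finset.mem_sdiff, Finset.mem_singleton] at hx
    split at h <;> injection h with h1 h2 <;> subst h1 <;>
      exact ⟨A', rfl, by tauto, by simp_all⟩
  all_goals (try split at h) <;> simp at h

theorem var_eq_subst_der {P : Tm} {x y z : ℕ} (hx : x ∉ Tm.fv P)
    (h : .var z = Tm.subst P y (.der (.var x))) : P = .var z ∧ z ≠ y ∧ z ≠ x := by
  cases P <;> simp only [Tm.subst] at h
  case var w =>
    simp only [Tm.fv, Finset.mem_singleton] at hx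
    split at h
    · simp at h
    · injection h with h
      subst h
      exact ⟨rfl, by assumption, Ne.symm hx⟩
  all_goals (try split at h) <;> simp at h

theorem der_eq_subst_der {A P : Tm} {x y : ℕ} (hx : x ∉ Tm.fv P)
    (h : .der A = Tm.subst P y (.der (.var x))) :
    (P = .var y ∧ A = .var x) ∨
      ∃ A', P = .der A' ∧ x ∉ Tm.fv A' ∧ A = Tm.subst A' y (.der (.var x)) := by
  cases P <;> simp only [Tm.subst] at h
  case var w =>
    split at h
    · injection h with h
      subst_vars
      exact .inl ⟨rfl, rfl⟩
    · simp at h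
  case der A' =>
    injection h with h
    exact .inr ⟨A', rfl, hx, h⟩
  all_goals (try split at h) <;> simp at h

theorem dersTm_var_eq_subst_der {P : Tm} {x y z j : ℕ} (hzx : z ≠ x) (hx : x ∉ Tm.fv P)
    (h : dersTm j (.var z) = Tm.subst P y (.der (.var x))) : P = dersTm j (.var z) := by
  induction j generalizing P with
  | zero => exact (var_eq_subst_der hx h).1
  | succ j ih =>
    rcases der_eq_subst_der hx h with ⟨rfl, hA⟩ | ⟨A', rfl, hx', hA⟩
    · cases j <;> simp [dersTm, hzx] at hA
    · rw [ih hx' hA]; rfl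

theorem dersTm_succ_var_eq_subst_der {P : Tm} {x y j : ℕ} (hx : x ∉ Tm.fv P)
    (h : dersTm (j + 1) (.var x) = Tm.subst P y (.der (.var x))) : P = dersTm j (.var y) := by
  induction j generalizing P with
  | zero =>
    rcases der_eq_subst_der hx h with ⟨rfl, -⟩ | ⟨A', rfl, hx', hA⟩
    · rfl
    · exact absurd rfl (var_eq_subst_der hx' hA).2.2
  | succ j ih =>
    rcases der_eq_subst_der hx h with ⟨rfl, hA⟩ | ⟨A', rfl, hx', hA⟩
    · simp [dersTm] at hA
    · rw [ih hx' hA]; rfl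

theorem iter_dersTm_eq_subst_der {P t : Tm} {x y z i n : ℕ} (hzx : z ≠ x) (hx : x ∉ Tm.fv P)
    (h : iter (dersTm i (.var z)) n t = Tm.subst P y (.der (.var x))) :
    ∃ t', P = iter (dersTm i (.var z)) n t' ∧ x ∉ Tm.fv t' ∧
      t = Tm.subst t' y (.der (.var x)) := by
  induction n generalizing P with
  | zero => exact ⟨P, rfl, hx, h⟩
  | succ n ih =>
    obtain ⟨A, B, rfl, hA, hB, h1, h2⟩ := app_eq_subst_der hx h
    obtain ⟨t', rfl, ht', h3⟩ := ih hB h2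
    rw [dersTm_var_eq_subst_der hzx hA h1]
    exact ⟨t', rfl, ht', h3⟩

theorem horner_eq_subst_der {P : Tm} {c : ℕ → ℕ} {x y i j k : ℕ} (h0 : x ≠ 0) (h1 : x ≠ 1)
    (hy : y ≠ 1) (hx : x ∉ Tm.fv P)
    (h : horner (dersTm i (.var 0)) (dersTm (j + 1) (.var x)) c k =
      Tm.subst P y (.der (.var x))) :
    P = horner (dersTm i (.var 0)) (dersTm j (.var y)) c k := by
  induction k generalizing P with
  | zero =>
    obtain ⟨t', rfl, ht', h3⟩ := iter_dersTm_eq_subst_der h0.symm hx h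
    rw [(var_eq_subst_der ht' h3).1, horner]
  | succ k ih =>
    obtain ⟨t', rfl, ht', h3⟩ := iter_dersTm_eq_subst_der h0.symm hx h
    obtain ⟨A, B, rfl, hA, hB, h4, h5⟩ := app_eq_subst_der ht' h3
    obtain ⟨C, D, rfl, hC, hD, h6, h7⟩ := app_eq_subst_der hA h4
    obtain ⟨E, rfl, hE, h8⟩ := bang_eq_subst_der hD h7
    obtain ⟨G, rfl, hG, h9⟩ := lam_eq_subst_der h1 hE h8
    rw [if_neg hy.symm] at h9
    rw [ih hG h9, dersTm_succ_var_eq_subst_der hC h6, (var_eq_subst_der hB h5).1, horner]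

theorem mem_fv_iter (G t : Tm) (n : ℕ) {x : ℕ} (h : x ∈ Tm.fv t) : x ∈ Tm.fv (iter G n t) := by
  induction n with
  | zero => exact h
  | succ n ih => simp [iter, Tm.fv, ih]

theorem fv_dersTm (j : ℕ) (M : Tm) : Tm.fv (dersTm j M) = Tm.fv M := by
  induction j with
  | zero => rfl
  | succ j ih => simpa [dersTm, Tm.fv] using ih

theorem notMem_fv_iter {G t : Tm} {n x : ℕ} (hG : x ∉ Tm.fv G) (ht : x ∉ Tm.fv t) :
    x ∉ Tm.fv (iter G n t) := by
  induction n with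
  | zero => exact ht
  | succ n ih => simp [iter, Tm.fv, hG, ih]

theorem notMem_fv_horner {F u : Tm} {c : ℕ → ℕ} {k x : ℕ} (hF : x ∉ Tm.fv F) (hu : x ∉ Tm.fv u)
    (hx : x ≠ 1) : x ∉ Tm.fv (horner F u c k) := by
  induction k with
  | zero => exact notMem_fv_iter hF (by simpa [Tm.fv] using hx)
  | succ k ih => exact notMem_fv_iter hF (by simp [Tm.fv, hx, hu, ih])

theorem mem_fv_horner_succ {F u : Tm} (c : ℕ → ℕ) (k : ℕ) {x : ℕ} (hu : x ∈ Tm.fv u) :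
    x ∈ Tm.fv (horner F u c (k + 1)) :=
  mem_fv_iter _ _ _ (by simp [Tm.fv, hu])

theorem ssubst_abs_horner (c : ℕ → ℕ) (i k m j : ℕ) {x : ℕ} (h0 : x ≠ 0) (h1 : x ≠ 1) :
    ssubst (.blam 0 (.lam 1 (horner (dersTm i (.var 0)) (dersTm j (.var x)) c (k + 1)))) x
        (bangsTm j (num 1 m)) =
      .blam 0 (.lam 1 (horner (dersTm i (.var 0)) (num 1 m) c (k + 1))) := by
  induction j generalizing x with
  | zero =>
    rw [bangsTm, ssubst_of_ne_bang _ _ (by simp [num])]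
    simp [Tm.subst, h0.symm, h1.symm, subst_horner _ _ _ _ h1, subst_dersTm, dersTm]
  | succ j ih =>
    rw [bangsTm]
    apply ssubst_bang_eq
    · refine ⟨.blam 0 (.lam 1 (horner (dersTm i (.var 0)) (dersTm j (.var (x + 1))) c (k + 1))),
        x + 1, ?_, ?_⟩
      · have := notMem_fv_horner (F := dersTm i (.var 0)) (u := dersTm j (.var (x + 1)))
          (c := c) (k := k + 1) (x := x) (by simpa [fv_dersTm, Tm.fv] using h0)
          (by simp [fv_dersTm, Tm.fv]) h1
        simp [Tm.fv, this]
      · simp [Tm.subst, subst_horner, h0, subst_dersTm, dersTm_der]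
    · intro P y hP h
      have hmem := mem_fv_horner_succ (F := dersTm i (.var 0)) (u := dersTm (j + 1) (.var x)) c k
        (x := x) (by simp [fv_dersTm, Tm.fv])
      obtain ⟨A, rfl, hA, h2⟩ := blam_eq_subst_der h0 hP h
      have hy0 : 0 ≠ y := by
        rintro rfl
        rw [if_pos rfl] at h2
        exact hA (by simp [← h2, Tm.fv, hmem, h1])
      rw [if_neg hy0] at h2
      obtain ⟨B, rfl, hB, h3⟩ := lam_eq_subst_der h1 hA h2
      have hy1 : 1 ≠ y := by
        rintro rfl
        rw [if_pos rfl] at h3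
        exact hB (by simp [← h3, hmem])
      rw [if_neg hy1] at h3
      rw [horner_eq_subst_der h0 h1 hy1.symm hB h3]
      exact ih hy0.symm hy1.symm

theorem subst_of_numBody_eq_subst_der {P T : Tm} {y m : ℕ} (hx : 0 ∉ Tm.fv P)
    (h : numBody 1 m = Tm.subst P y (.der (.var 0))) :
    Tm.subst P y T = iter T m (.var 1) := by
  induction m generalizing P with
  | zero =>
    obtain ⟨rfl, hy, -⟩ := var_eq_subst_der hx h
    simp [Tm.subst, hy, iter]
  | succ m ih =>
    obtain ⟨A, B, rfl, hA, hB, h1, h2⟩ := app_eq_subst_der hx h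
    rw [dersTm_succ_var_eq_subst_der (j := 0) hA h1]
    simp [Tm.subst, dersTm, iter, ih hB h2]

theorem ssubst_lam_numBody (m : ℕ) {T : Tm} (hT : ∀ Q, T ≠ .bang Q) :
    ssubst (.lam 1 (numBody 1 m)) 0 (.bang T) = .lam 1 (iter T m (.var 1)) := by
  apply ssubst_bang_eq
  · refine ⟨.lam 1 (iter (.var 2) m (.var 1)), 2, ?_, ?_⟩
    · have := notMem_fv_iter (G := .var 2) (t := .var 1) (n := m) (x := 0)
        (by simp [Tm.fv]) (by simp [Tm.fv])
      simp [Tm.fv, this]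
    · simp [Tm.subst, numBody_eq_iter, subst_iter, dersTm]
  · intro P y hP h
    rw [ssubst_of_ne_bang _ _ hT]
    obtain ⟨A, rfl, hA, h1⟩ := lam_eq_subst_der (by simp) hP h
    by_cases hy : 1 = y
    · rw [if_pos hy] at h1
      subst h1
      cases m with
      | zero => simp [Tm.subst, hy, numBody, iter]
      | succ m => simp [numBody, dersTm, Tm.fv] at hA
    · rw [if_neg hy] at h1
      simp [Tm.subst, hy, subst_of_numBody_eq_subst_der hA h1]

/-! ### Evaluation of the Horner scheme -/

/-- Iterating a function that reduces to `λz. F^v z` amounts to iterating `F`. -/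
theorem red_iter_lam {i v : ℕ} {B : Tm}
    (h : Red B (iter (dersTm i (.var 0)) v (.var 1))) (m : ℕ) (t : Tm) :
    Red (iter (.lam 1 B) m t) (iter (dersTm i (.var 0)) (m * v) t) := by
  induction m with
  | zero => rw [Nat.zero_mul]; exact .refl
  | succ m ih =>
    rw [Nat.succ_mul, Nat.add_comm (m * v), iter_add (dersTm i (.var 0))]
    refine (ih.appR _).trans (((h.lam 1).appL _).tail ?_)
    have := Step.beta 1 (iter (dersTm i (.var 0)) v (.var 1))
      (iter (dersTm i (.var 0)) (m * v) t)
    rwa [subst_iter, subst_dersTm_var_of_ne _ (by simp), Tm.subst, if_pos rfl] at this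

/-- A numeral applied to a boxed function iterates that function. -/
theorem red_num_app (m : ℕ) (B t : Tm) :
    Red (.app (.app (num 1 m) (.bang (.lam 1 B))) t) (iter (.lam 1 B) m t) := by
  have h1 := Step.bbeta 0 (.lam 1 (numBody 1 m)) (.lam 1 B)
  rw [ssubst_lam_numBody m (by simp)] at h1
  have h2 := Step.beta 1 (iter (.lam 1 B) m (.var 1)) t
  simp only [subst_iter, Tm.subst, if_pos] at h2
  exact .tail (.single (.appL t h1)) h2

theorem red_horner (c : ℕ → ℕ) (i m k : ℕ) :
    Red (horner (dersTm i (.var 0)) (num 1 m) c k) (numBody i (hornerVal c m k)) := by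
  rw [numBody_eq_iter]
  induction k with
  | zero => exact .refl
  | succ k ih =>
    rw [hornerVal, iter_add, horner]
    exact Red.iter _ _ ((red_num_app m _ _).trans (red_iter_lam ih m _))

theorem hornerVal_eq_sum (c : ℕ → ℕ) (n k : ℕ) :
    hornerVal c n k = ∑ j ∈ Finset.range (k + 1), c j * n ^ (k - j) := by
  induction k with
  | zero => simp [hornerVal]
  | succ k ih =>
    rw [hornerVal, ih, Finset.sum_range_succ _ (k + 1), Finset.mul_sum, Nat.add_comm]
    congr 1
    · refine Finset.sum_congr rfl fun j hj => ?_
      rw [Nat.succ_sub (Finset.mem_range_succ_iff.mp hj), pow_succ]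
      ring
    · simp

theorem hornerVal_coeff (p : Polynomial ℕ) (n : ℕ) :
    hornerVal (fun j => p.coeff (p.natDegree - j)) n p.natDegree = p.eval n := by
  rw [hornerVal_eq_sum, Polynomial.eval_eq_sum_range, ← Finset.sum_range_reflect]
  refine Finset.sum_congr rfl fun j hj => ?_
  have := Finset.mem_range_succ_iff.mp hj
  simp only [Nat.add_sub_cancel]
  rw [Nat.sub_sub_self this]

/-! ### Typing -/

/-- Derivability in PSTA. -/
abbrev Typed (Γ : Ctx) (M : Tm) (σ : Ty) : Prop := Nonempty (Deriv Γ M σ)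

/-- The type `α ⊸ α`. -/
abbrev endo : Ty := .arr (.tvar 0) (.tvar 0)

theorem Typed.app {Γ Γ' : Ctx} {M N : Tm} {σ A : Ty} (hA : IsLinear A)
    (h : Typed Γ M (.arr σ A)) (h' : Typed Γ' N σ) : Typed (Γ + Γ') (.app M N) A :=
  let ⟨D⟩ := h
  let ⟨D'⟩ := h'
  ⟨.app hA D D'⟩

theorem Typed.lam {Γ : Ctx} {x : ℕ} {A B : Ty} {M : Tm} (hA : IsLinear A) (hB : IsLinear B)
    (h : Typed ((x, A) ::ₘ Γ) M B) : Typed Γ (.lam x M) (.arr A B) :=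
  let ⟨D⟩ := h
  ⟨.larr hA hB D⟩

theorem isTy_bangsTy (i : ℕ) {A : Ty} (hA : IsTy A) : IsTy (bangsTy i A) := by
  induction i with
  | zero => exact hA
  | succ i ih => exact ⟨rfl, ih⟩

theorem isTy_endo : IsTy endo := by simp [IsTy, okTy]

theorem isLinear_NTy (i : ℕ) : IsLinear (NTy i) := by
  have := isTy_bangsTy i isTy_endo
  simp_all [IsTy, IsLinear, NTy, okTy]

theorem fv_bangsTy (i : ℕ) (A : Ty) : Ty.fv (bangsTy i A) = Ty.fv A := by
  induction i with
  | zero => rfl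
  | succ i ih => simpa [bangsTy, Ty.fv] using ih

theorem fv_NTy (i : ℕ) : Ty.fv (NTy i) = ∅ := by
  simp [NTy, Ty.fv, fv_bangsTy]

theorem subst_bangsTy (i : ℕ) (A : Ty) (α : ℕ) (B : Ty) :
    Ty.subst (bangsTy i A) α B = bangsTy i (Ty.subst A α B) := by
  induction i with
  | zero => rfl
  | succ i ih => simpa [bangsTy, Ty.subst] using ih

theorem Typed.instNTy {Γ : Ctx} {M : Tm} {i : ℕ} (h : Typed Γ M (NTy i)) {B : Ty}
    (hB : IsLinear B) :
    Typed Γ M (.arr (bangsTy i (.arr B B)) (.arr B B)) := by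
  obtain ⟨D⟩ := h
  have D' := Deriv.allE 0 B hB D
  simp only [Ty.subst, subst_bangsTy, if_pos] at D'
  exact ⟨D'⟩

theorem substDers_cons (M : Tm) (q : ℕ × ℕ) (prs : List (ℕ × ℕ)) :
    substDers M (q :: prs) = substDers (Tm.subst M q.1 (.der (.var q.2))) prs := rfl

theorem substDers_append (M : Tm) (prs prs' : List (ℕ × ℕ)) :
    substDers M (prs ++ prs') = substDers (substDers M prs) prs' :=
  List.foldl_append

theorem substDersOne_replicate (M : Tm) (m w z : ℕ) :
    substDersOne M (List.replicate m w) z = substDers M (List.replicate m (w, z)) := by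
  rw [substDersOne, substDers, ← List.map_replicate (f := fun w => (w, z)), List.foldl_map]

theorem substDers_lam (z : ℕ) (M : Tm) {prs : List (ℕ × ℕ)} (h : ∀ q ∈ prs, z ≠ q.1) :
    substDers (.lam z M) prs = .lam z (substDers M prs) := by
  induction prs generalizing M with
  | nil => rfl
  | cons q prs ih =>
    rw [substDers_cons, Tm.subst, if_neg (h q (by simp)), ih _ fun q hq => h q (by simp [hq])]
    rfl

/-- Derelicting all occurrences of a variable standing for the heads of the Horner scheme. -/
theorem substDers_horner_head (c : ℕ → ℕ) (k a m : ℕ) {w z y b : ℕ} (hw : w ≠ 1)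
    (hwz : w ≠ z) (hwy : w ≠ y) (hm : m = headCount c k) :
    substDers (horner (dersTm a (.var w)) (dersTm b (.var y)) c k) (List.replicate m (w, z)) =
      horner (dersTm (a + 1) (.var z)) (dersTm b (.var y)) c k := by
  have key : ∀ m,
      substDers (horner (dersTm (a + 1) (.var z)) (dersTm b (.var y)) c k)
        (List.replicate m (w, z)) =
      horner (dersTm (a + 1) (.var z)) (dersTm b (.var y)) c k := by
    intro m
    induction m with
    | zero => rfl
    | succ m ih =>
      rwa [List.replicate_succ, substDers_cons, subst_horner _ _ _ _ hw,
        subst_dersTm_var_of_ne _ hwz.symm, subst_dersTm_var_of_ne _ hwy.symm]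
  cases m with
  | zero => exact horner_congr_head _ _ hm.symm
  | succ m =>
    rw [List.replicate_succ, substDers_cons, subst_horner _ _ _ _ hw,
      subst_dersTm_var_of_ne _ hwy.symm, subst_dersTm, Tm.subst, if_pos rfl, dersTm_der, key]

/-- Derelicting all occurrences of a variable standing for the numeral in the Horner scheme. -/
theorem substDers_horner_arg (c : ℕ → ℕ) (k a : ℕ) {w z y b : ℕ} (hw : w ≠ 1)
    (hwz : w ≠ z) (hwy : w ≠ y) :
    substDers (horner (dersTm a (.var y)) (dersTm b (.var w)) c k) (List.replicate k (w, z)) =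
      horner (dersTm a (.var y)) (dersTm (b + 1) (.var z)) c k := by
  have key : ∀ m,
      substDers (horner (dersTm a (.var y)) (dersTm (b + 1) (.var z)) c k)
        (List.replicate m (w, z)) =
      horner (dersTm a (.var y)) (dersTm (b + 1) (.var z)) c k := by
    intro m
    induction m with
    | zero => rfl
    | succ m ih =>
      rwa [List.replicate_succ, substDers_cons, subst_horner _ _ _ _ hw,
        subst_dersTm_var_of_ne _ hwz.symm, subst_dersTm_var_of_ne _ hwy.symm]
  cases k with
  | zero => rfl
  | succ k =>
    rw [List.replicate_succ, substDers_cons, subst_horner _ _ _ _ hw,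
      subst_dersTm_var_of_ne _ hwy.symm, subst_dersTm, Tm.subst, if_pos rfl, dersTm_der, key]

theorem typed_dersTm (b x : ℕ) {A : Ty} (hA : IsLinear A) :
    Typed {(x, bangsTy b A)} (dersTm b (.var x)) A := by
  induction b generalizing x with
  | zero => exact ⟨.ax x A hA⟩
  | succ b ih =>
    obtain ⟨D⟩ := ih (x + 1)
    have D' := Deriv.m (Γ := 0) [x + 1] x (by simpa using D)
    simp only [substDersOne, List.foldl_cons, List.foldl_nil, subst_dersTm, Tm.subst, if_pos,
      dersTm_der] at D'
    exact ⟨D'⟩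

theorem typed_iter {Γ : Ctx} {q : ℕ × Ty} {F t : Tm} {A : Ty} (hA : IsLinear A)
    (hF : Typed {q} F (.arr A A)) (n : ℕ) (ht : Typed Γ t A) :
    Typed (Multiset.replicate n q + Γ) (iter F n t) A := by
  induction n with
  | zero => simpa [iter] using ht
  | succ n ih =>
    rw [Multiset.replicate_succ, ← Multiset.singleton_add, add_assoc]
    exact hF.app hA ih

theorem typed_horner (c : ℕ → ℕ) (k a b : ℕ) {f x : ℕ} (hf : f ≠ 1) (hx : x ≠ 1) (hfx : f ≠ x)
    (ha : k ≤ a) (hb : k ≤ b + 1) :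
    Typed ((1, .tvar 0) ::ₘ (Multiset.replicate (headCount c k) (f, bangsTy a endo) +
        Multiset.replicate k (x, bangsTy b (NTy 1))))
      (horner (dersTm a (.var f)) (dersTm b (.var x)) c k) (.tvar 0) := by
  have hα : IsLinear (.tvar 0) := by simp [IsLinear, okTy]
  have hE : IsLinear endo := by simp [IsLinear, okTy]
  induction k generalizing a b f x with
  | zero =>
    simpa [headCount, horner, ← Multiset.singleton_add, add_comm] using
      typed_iter hα (typed_dersTm a f hE) (c 0) ⟨.ax 1 (.tvar 0) hα⟩
  | succ k ih =>
    obtain ⟨a, rfl⟩ : ∃ a', a = a' + 1 := ⟨a - 1, by omega⟩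
    have box : Typed (Multiset.replicate (headCount c k) (f, bangsTy (a + 1) endo) +
        Multiset.replicate k (x, bangsTy b (NTy 1)))
        (.bang (.lam 1 (horner (dersTm (a + 1) (.var f)) (dersTm b (.var x)) c k)))
        (.bang endo) := by
      have main : ∀ b', k ≤ b' + 1 →
          Typed (Multiset.replicate (headCount c k) (f, bangsTy (a + 1) endo) +
            Multiset.replicate k (x, bangsTy (b' + 1) (NTy 1)))
          (.bang (.lam 1 (horner (dersTm (a + 1) (.var f)) (dersTm (b' + 1) (.var x)) c k)))
          (.bang endo) := by
        intro b' hb'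
        obtain ⟨D⟩ := Typed.lam hα hα (ih a b' (f := f + x + 2) (x := f + x + 3) (by omega)
          (by omega) (by omega) (by omega) hb')
        have D' := Deriv.sp (M := .lam 1 (horner (dersTm a (.var (f + x + 2)))
            (dersTm b' (.var (f + x + 3))) c k)) (τ := endo)
          (List.replicate (headCount c k) (f + x + 2, bangsTy a endo) ++
            List.replicate k (f + x + 3, bangsTy b' (NTy 1)))
          (List.replicate (headCount c k) f ++ List.replicate k x) (by simp)
          (by simpa [← Multiset.coe_add, Multiset.coe_replicate] using D)
        have hM : substDers (.lam 1 (horner (dersTm a (.var (f + x + 2)))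
            (dersTm b' (.var (f + x + 3))) c k))
            ((List.replicate (headCount c k) (f + x + 2) ++ List.replicate k (f + x + 3)).zip
              (List.replicate (headCount c k) f ++ List.replicate k x)) =
            .lam 1 (horner (dersTm (a + 1) (.var f)) (dersTm (b' + 1) (.var x)) c k) := by
          rw [List.zip_append (by simp), List.zip_replicate', List.zip_replicate', substDers_lam,
            substDers_append, substDers_horner_head _ _ _ _ (by omega) (by omega) (by omega) rfl,
            substDers_horner_arg _ _ _ (by omega) (by omega) (by omega)]
          simp only [List.mem_append, List.mem_replicate]
          rintro q (⟨-, rfl⟩ | ⟨-, rfl⟩) <;> simp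
        rw [List.map_append, List.map_replicate, List.map_replicate, hM,
          List.zipWith_append (by simp), List.zipWith_replicate', List.zipWith_replicate',
          ← Multiset.coe_add, Multiset.coe_replicate, Multiset.coe_replicate] at D'
        exact ⟨D'⟩
      cases b with
      | zero =>
        obtain rfl : k = 0 := by omega
        simpa [horner] using main 0 (by omega)
      | succ b => exact main b (by omega)
    have hu := ((typed_dersTm b x (isLinear_NTy 1)).instNTy hα).app hE box
    have := typed_iter hα (typed_dersTm (a + 1) f hE) (c (k + 1))
      (hu.app hα ⟨.ax 1 (.tvar 0) hα⟩)
    rw [horner, headCount]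
    convert this using 1
    simp only [Multiset.replicate_add, Multiset.replicate_succ, ← Multiset.singleton_add]
    ac_rfl

/-- Contraction of `m` copies of an assumption. -/
theorem Typed.contract {Γ : Ctx} {w : ℕ} {σ τ : Ty} {M : Tm} (m z : ℕ)
    (h : Typed (Γ + Multiset.replicate m (w, σ)) M τ) :
    Typed ((z, .bang σ) ::ₘ Γ) (substDers M (List.replicate m (w, z))) τ := by
  obtain ⟨D⟩ := h
  rw [← substDersOne_replicate]
  exact ⟨.m (σ := σ) _ z (by simpa [Multiset.coe_replicate] using D)⟩

theorem Typed.closeNTy {Γ : Ctx} {i : ℕ} {M : Tm} (hΓ : ∀ p ∈ Γ, Ty.fv p.2 = ∅)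
    (h : Typed ((1, .tvar 0) ::ₘ (0, bangsTy (i + 1) endo) ::ₘ Γ) M (.tvar 0)) :
    Typed Γ (.blam 0 (.lam 1 M)) (NTy (i + 1)) := by
  have hα : IsLinear (.tvar 0) := by simp [IsLinear, okTy]
  obtain ⟨D⟩ := h.lam hα hα
  have D' := Deriv.earr (isTy_bangsTy i isTy_endo) (by simp [IsLinear, okTy]) D
  refine ⟨.allI 0 0 (fun p hp => by simp [hΓ p hp]) ?_⟩
  simp only [Ty.subst, subst_bangsTy, if_pos]
  exact D'

theorem typed_num (i c : ℕ) : Typed 0 (num (i + 1) c) (NTy (i + 1)) := by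
  have h := typed_horner (fun _ => c) 0 i 0 (f := 2) (x := 3) (by simp) (by simp) (by simp)
    (by simp) (by simp)
  rw [Multiset.replicate_zero, add_zero, ← Multiset.singleton_add] at h
  have h' := h.contract _ 0
  rw [substDers_horner_head _ _ _ _ (by simp) (by simp) (by simp) rfl] at h'
  rw [num, numBody_eq_iter]
  refine Typed.closeNTy (by simp) ?_
  rw [Multiset.cons_swap]
  exact h'

theorem typed_abs_horner (c : ℕ → ℕ) (k : ℕ) :
    Typed {(2, bangsTy (k + 1) (NTy 1))}
      (.blam 0 (.lam 1 (horner (dersTm (2 * (k + 1) + 1) (.var 0)) (dersTm (k + 1) (.var 2)) c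
        (k + 1)))) (NTy (2 * (k + 1) + 1)) := by
  have h := typed_horner c (k + 1) (2 * (k + 1)) k (f := 3) (x := 4) (by simp) (by simp) (by simp)
    (by omega) (by omega)
  rw [← Multiset.cons_add] at h
  have h' := h.contract _ 2
  rw [substDers_horner_arg _ _ _ (by simp) (by simp) (by simp), ← Multiset.singleton_add,
    ← Multiset.singleton_add, ← add_assoc] at h'
  have h'' := h'.contract _ 0
  rw [substDers_horner_head _ _ _ _ (by simp) (by simp) (by simp) rfl] at h''
  refine Typed.closeNTy (by simp [fv_bangsTy, fv_NTy]) ?_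
  convert h'' using 1
  rw [Multiset.cons_swap]
  exact congrArg (Multiset.cons _) (Multiset.pair_comm _ _)

/-! ### Constant polynomials -/

theorem typed_const (c : ℕ) :
    Typed {(2, NTy 1)} (.app (.app (.var 2) (.bang (.lam 1 (.var 1)))) (num 1 c)) (NTy 1) := by
  have hN := isLinear_NTy 1
  have hNN : IsLinear (.arr (NTy 1) (NTy 1)) := by
    have := isTy_bangsTy 1 isTy_endo
    simp_all [IsTy, IsLinear, NTy, okTy]
  have hI : Typed 0 (.bang (.lam 1 (.var 1))) (bangsTy 1 (.arr (NTy 1) (NTy 1))) := by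
    have D : Deriv (([] : List (ℕ × Ty)) : Ctx) (.lam 1 (.var 1)) (.arr (NTy 1) (NTy 1)) :=
      .larr hN hN (.ax 1 _ hN)
    exact ⟨.sp [] [] rfl D⟩
  have hx : Typed {(2, NTy 1)} (.var 2) (NTy 1) := ⟨.ax 2 _ hN⟩
  simpa using ((hx.instNTy hN).app hNN hI).app hN (typed_num 0 c)

theorem red_const (c n : ℕ) :
    Red (ssubst (.app (.app (.var 2) (.bang (.lam 1 (.var 1)))) (num 1 c)) 2 (num 1 n))
      (num 1 c) := by
  rw [ssubst_of_ne_bang _ _ (by simp [num])]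
  simp only [Tm.subst, subst_num 1 c (x := 2) (by simp) (by simp)]
  have h := red_iter_lam (i := 0) (v := 0) (B := .var 1) .refl n (num 1 c)
  exact (red_num_app n _ _).trans h

/-- Representing polynomial functions: for every polynomial p
with natural coefficients and degree d there is a term p̲ with
x : !^d N ⊢ p̲ : N_{2d+1} in PSTA such that for every n, the term
p̲{!^d n̲ / x} multi-step surface reduces to the Dirac distribution on the
indexed numeral (p(n))̲_{2d+1}.  Here the free variable x is var 2. -/
theorem polynomial_completeness (p : Polynomial ℕ) :
    ∃ pbar : Tm,
      Nonempty (Deriv {(2, bangsTy p.natDegree (NTy 1))} pbar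
        (NTy (2 * p.natDegree + 1))) ∧
      ∀ n : ℕ,
        Nonempty (MDeriv (ssubst pbar 2 (bangsTm p.natDegree (num 1 n)))
          (PMF.pure (num (2 * p.natDegree + 1) (Polynomial.eval n p)))) := by
  obtain hd | ⟨k, hd⟩ : p.natDegree = 0 ∨ ∃ k, p.natDegree = k + 1 := by
    cases p.natDegree <;> simp
  · obtain ⟨c, rfl⟩ := Polynomial.natDegree_eq_zero.mp hd
    simp only [Polynomial.natDegree_C, Polynomial.eval_C]
    exact ⟨_, typed_const c, fun n => (red_const c n).mderiv (snf_num _ _)⟩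
  · refine ⟨.blam 0 (.lam 1 (horner (dersTm (2 * p.natDegree + 1) (.var 0))
      (dersTm p.natDegree (.var 2)) (fun j => p.coeff (p.natDegree - j)) p.natDegree)), ?_, ?_⟩
    · rw [hd]
      exact typed_abs_horner _ k
    · intro n
      refine Red.mderiv ?_ (snf_num _ _)
      rw [← hornerVal_coeff, hd, ssubst_abs_horner _ _ _ _ _ (by simp) (by simp)]
      exact ((red_horner _ _ _ _).lam 1).blam 0

end PSTA
end
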